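/- A finitely generated group G satisfies the universal theory of a nonabelian free group F (i.e., every universal first-order sentence true in F is true in G) if and only if G is fully residually free, meaning for every finite subset S of G there exists a group homomorphism from G to a free group that is injective on S. -/

import Mathlib

open FirstOrder

/-- The first-order language of groups: a binary multiplication, a unary inverse,
and a constant for the identity. -/
def grpLang : FirstOrder.Language :=
  ⟨fun n => match n with | 0 => Unit | 1 => Unit | 2 => Unit | _ => Empty,
   fun _ => Empty⟩

/-- Any group is a structure for the language of groups, interpreting the symbols
in the natural way. -/
instance grpStructure (G : Type*) [Group G] : grpLang.Structure G where
  funMap {n} f v :=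
    match n, f, v with
    | 0, _, _ => 1
    | 1, _, v => (v 0)⁻¹
    | 2, _, v => v 0 * v 1
  RelMap {n} r _ := nomatch r

/-- A sentence is universal if it is a universally quantified quantifier-free formula. -/
def IsUniversalSentence (φ : grpLang.Sentence) : Prop :=
  ∃ (n : ℕ) (ψ : grpLang.BoundedFormula Empty n), ψ.IsQF ∧ φ = ψ.alls

/-- `G` is fully residually free: for every finite subset `S` of `G` there is a
homomorphism from `G` to a free group which is injective on `S`. -/
def FullyResiduallyFree (G : Type*) [Group G] : Prop :=
  ∀ S : Finset G, ∃ (α : Type) (f : G →* FreeGroup α), Set.InjOn f (S : Set G)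

namespace Matrix.SpecialLinearGroup

/-- The upper (`i = true`) or lower (`i = false`) unitriangular matrix with off-diagonal
entry `2 * k`. -/
def evenUnipotentMatrix (i : Bool) (k : ℤ) : Matrix (Fin 2) (Fin 2) ℤ :=
  if i then !![1, 2 * k; 0, 1] else !![1, 0; 2 * k, 1]

theorem evenUnipotentMatrix_zero (i : Bool) : evenUnipotentMatrix i 0 = 1 := by
  cases i <;> simp [evenUnipotentMatrix, Matrix.one_fin_two]

theorem evenUnipotentMatrix_add (i : Bool) (k l : ℤ) :
    evenUnipotentMatrix i (k + l) = evenUnipotentMatrix i k * evenUnipotentMatrix i l := by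
  cases i <;> simp [evenUnipotentMatrix, mul_add, add_comm]

/-- The one-parameter subgroup of upper (`i = true`) or lower (`i = false`) unitriangular
integer matrices with even off-diagonal entry. -/
def evenUnipotent (i : Bool) : Multiplicative ℤ →* SpecialLinearGroup (Fin 2) ℤ where
  toFun k := ⟨evenUnipotentMatrix i k.toAdd, by
    cases i <;> simp [evenUnipotentMatrix, Matrix.det_fin_two]⟩
  map_one' := Subtype.ext (evenUnipotentMatrix_zero i)
  map_mul' x y := Subtype.ext (evenUnipotentMatrix_add i x.toAdd y.toAdd)

/-- A free group of rank two embeds in `SL(2, ℤ)`. -/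
theorem exists_freeGroup_bool_injective :
    ∃ f : FreeGroup Bool →* SpecialLinearGroup (Fin 2) ℤ, Function.Injective f := by
  let f (i : Bool) : FreeGroup Unit →* SpecialLinearGroup (Fin 2) ℤ :=
    (evenUnipotent i).comp (FreeGroup.lift fun _ => Multiplicative.ofAdd 1)
  refine ⟨(Monoid.CoprodI.lift f).comp freeGroupEquivCoprodI.toMonoidHom, ?_⟩
  refine Function.Injective.comp (g := Monoid.CoprodI.lift f) ?_ freeGroupEquivCoprodI.injective
  let _ : MulAction (SpecialLinearGroup (Fin 2) ℤ) (Fin 2 → ℤ) :=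
    MulAction.compHom _ (toLin' : SpecialLinearGroup (Fin 2) ℤ →* _)
  let X : Bool → Set (Fin 2 → ℤ) := fun i => if i then {v | |v 1| < |v 0|} else {v | |v 0| < |v 1|}
  refine Monoid.CoprodI.lift_injective_of_ping_pong f (Or.inr ⟨true, ?_⟩) X ?_ ?_ ?_
  · exact le_trans (Cardinal.natCast_lt_aleph0 (n := 3)).le (Cardinal.aleph0_le_mk _)
  · rintro (_ | _)
    · exact ⟨![0, 1], by simp [X]⟩
    · exact ⟨![1, 0], by simp [X]⟩
  · rintro (_ | _) (_ | _) hij <;> simp only [ne_eq, not_true_eq_false, reduceCtorEq] at hij <;>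
    · refine Set.disjoint_left.mpr fun v hv hv' => ?_
      simp only [X, Bool.false_eq_true, if_true, if_false, Set.mem_ofPred_eq] at hv hv'
      exact lt_asymm hv hv'
  · intro i j hij h hne
    obtain ⟨k, hk, hfk⟩ : ∃ k : ℤ, k ≠ 0 ∧ f i h = evenUnipotent i (Multiplicative.ofAdd k) := by
      obtain ⟨k, rfl⟩ := FreeGroup.freeGroupUnitEquivInt.symm.surjective h
      refine ⟨k, ?_, ?_⟩
      · rintro rfl
        exact hne (by simp [FreeGroup.freeGroupUnitEquivInt])
      · simp [f, FreeGroup.freeGroupUnitEquivInt, ← ofAdd_zsmul]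
    rw [hfk]
    rintro _ ⟨v, hv, rfl⟩
    change evenUnipotentMatrix i k *ᵥ v ∈ X i
    have key (x y : ℤ) (hxy : |x| < |y|) : |y| < |x + 2 * k * y| := by
      have h1 : |2 * k * y| ≤ |x + 2 * k * y| + |x| := by
        simpa using abs_sub (x + 2 * k * y) x
      have h2 : 2 * |y| ≤ |2 * k * y| := by
        rw [abs_mul, abs_mul]
        have := Int.one_le_abs hk
        have h0 := abs_nonneg y
        norm_num
        nlinarith
      linarith
    cases i <;> cases j <;> simp only [ne_eq, not_true_eq_false, reduceCtorEq] at hij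
    · have := key (v 1) (v 0) (by simpa [X] using hv)
      simpa [X, evenUnipotentMatrix, Matrix.mulVec, dotProduct, Fin.sum_univ_two, add_comm]
        using this
    · have := key (v 0) (v 1) (by simpa [X] using hv)
      simpa [X, evenUnipotentMatrix, Matrix.mulVec, dotProduct, Fin.sum_univ_two] using this

/-- `SL(m, A)` over a Noetherian ring `A` is equationally Noetherian, for equations without
constants in finitely many variables. -/
theorem exists_finset_lift_eq_one {m ι A : Type} [Fintype m] [DecidableEq m] [Finite ι]
    [CommRing A] [IsNoetherianRing A] (K : Set (FreeGroup ι)) :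
    ∃ K₀ : Finset (FreeGroup ι), (K₀ : Set (FreeGroup ι)) ⊆ K ∧
      ∀ x : ι → SpecialLinearGroup m A,
        (∀ w ∈ K₀, FreeGroup.lift x w = 1) → ∀ w ∈ K, FreeGroup.lift x w = 1 := by
  classical
  let P := MvPolynomial (ι × m × m) A
  let M (i : ι) : Matrix m m P := Matrix.of fun a b => MvPolynomial.X (i, a, b)
  let J : Ideal P := Ideal.span (Set.range fun i => (M i).det - 1)
  let N (i : ι) : SpecialLinearGroup m (P ⧸ J) :=
    ⟨(M i).map (Ideal.Quotient.mk J), by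
      rw [← RingHom.mapMatrix_apply, ← RingHom.map_det, ← map_one (Ideal.Quotient.mk J),
        Ideal.Quotient.eq]
      exact Ideal.subset_span ⟨i, rfl⟩⟩
  let ρ : FreeGroup ι →* SpecialLinearGroup m (P ⧸ J) := FreeGroup.lift N
  let ent (p : FreeGroup ι × m × m) : P ⧸ J :=
    (ρ p.1).1 p.2.1 p.2.2 - (1 : Matrix m m (P ⧸ J)) p.2.1 p.2.2
  obtain ⟨s, hs, hspan⟩ := (Submodule.fg_span_iff_fg_span_finset_subset
    (R := P ⧸ J) (ent '' (K ×ˢ Set.univ))).1 (IsNoetherian.noetherian _)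
  obtain ⟨t, ht, rfl⟩ := Finset.subset_set_image_iff.1 hs
  refine ⟨t.image Prod.fst, ?_, fun x hx w hw => ?_⟩
  · intro w hw
    obtain ⟨p, hp, rfl⟩ := Finset.mem_image.1 (Finset.mem_coe.1 hw)
    exact (ht hp).1
  let e : P ⧸ J →+* A := Ideal.Quotient.lift J
    (MvPolynomial.eval fun p : ι × m × m => (x p.1).1 p.2.1 p.2.2) (by
      change J ≤ RingHom.ker _
      refine Ideal.span_le.2 ?_
      rintro _ ⟨i, rfl⟩
      have : (MvPolynomial.eval fun p : ι × m × m => (x p.1).1 p.2.1 p.2.2).mapMatrix (M i)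
          = (x i).1 := by
        ext a b
        simp [M]
      simp [RingHom.mem_ker, RingHom.map_det, this])
  have he : (map e).comp ρ = FreeGroup.lift x := by
    refine FreeGroup.ext_hom _ _ fun i => ?_
    rw [MonoidHom.comp_apply, FreeGroup.lift_apply_of, FreeGroup.lift_apply_of]
    refine Subtype.ext ?_
    change ((M i).map (Ideal.Quotient.mk J)).map e = (x i).1
    ext a b
    exact MvPolynomial.eval_X _
  have hent (p : FreeGroup ι × m × m) : e (ent p) =
      (FreeGroup.lift x p.1).1 p.2.1 p.2.2 - (1 : Matrix m m A) p.2.1 p.2.2 := by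
    rw [← he]
    simp [ent, Matrix.one_apply, apply_ite e]
  have hker : Ideal.span (ent '' (K ×ˢ Set.univ)) ≤ RingHom.ker e := by
    rw [Ideal.span, hspan]
    refine Ideal.span_le.2 ?_
    intro y hy
    obtain ⟨p, hp, rfl⟩ := Finset.mem_image.1 (Finset.mem_coe.1 hy)
    rw [SetLike.mem_coe, RingHom.mem_ker, hent, hx _ (Finset.mem_image_of_mem _ hp)]
    simp
  ext a b
  have := hker (Ideal.subset_span ⟨(w, a, b), ⟨hw, trivial⟩, rfl⟩)
  rw [RingHom.mem_ker, hent] at this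
  exact sub_eq_zero.1 this

end Matrix.SpecialLinearGroup

namespace FreeGroup

/-- The free group of countable rank embeds in the free group of rank two. -/
theorem exists_int_bool_injective :
    ∃ f : FreeGroup ℤ →* FreeGroup Bool, Function.Injective f := by
  let σ : Multiplicative ℤ →* MulAut (FreeGroup ℤ) :=
    { toFun k := freeGroupCongr (Equiv.addRight k.toAdd)
      map_one' := by
        ext x
        simp
      map_mul' a b := by
        refine MulEquiv.toMonoidHom_injective (ext_hom _ _ fun x => ?_)
        simp [add_comm, add_left_comm] }
  let f : FreeGroup ℤ →* FreeGroup Bool :=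
    lift fun k => of true ^ k * of false * (of true ^ k)⁻¹
  let g : FreeGroup Bool →* FreeGroup ℤ ⋊[σ] Multiplicative ℤ :=
    lift fun b => if b then SemidirectProduct.inr (Multiplicative.ofAdd 1)
      else SemidirectProduct.inl (of 0)
  have hgf : g.comp f = SemidirectProduct.inl := by
    refine ext_hom _ _ fun k => ?_
    have : g (f (of k)) = SemidirectProduct.inr (Multiplicative.ofAdd k) *
        SemidirectProduct.inl (of 0) * SemidirectProduct.inr (Multiplicative.ofAdd k)⁻¹ := by
      simp only [f, g, lift_apply_of, _root_.map_mul, _root_.map_inv, _root_.map_zpow, if_true,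
        Bool.false_eq_true, if_false]
      rw [← _root_.map_zpow, ← ofAdd_zsmul, smul_eq_mul, mul_one]
    rw [MonoidHom.comp_apply, this, ← SemidirectProduct.inl_aut]
    simp [σ]
  refine ⟨f, Function.Injective.of_comp (f := g) ?_⟩
  rw [← MonoidHom.coe_comp, hgf]
  exact SemidirectProduct.inl_injective

theorem exists_finset_mem_closure {α : Type*} (x : FreeGroup α) :
    ∃ L : Finset α, x ∈ Subgroup.closure (of '' (L : Set α)) := by
  classical
  induction x using FreeGroup.induction_on with
  | C1 => exact ⟨∅, one_mem _⟩
  | of a => exact ⟨{a}, Subgroup.subset_closure ⟨a, by simp, rfl⟩⟩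
  | inv_of a h =>
    obtain ⟨L, hL⟩ := h
    exact ⟨L, inv_mem hL⟩
  | mul x y hx hy =>
    obtain ⟨L, hL⟩ := hx
    obtain ⟨L', hL'⟩ := hy
    refine ⟨L ∪ L', mul_mem (Subgroup.closure_mono ?_ hL) (Subgroup.closure_mono ?_ hL')⟩ <;>
    · refine Set.image_mono ?_
      simp

/-- A finite subset of a free group is mapped injectively by some homomorphism to any given
free group of rank at least two. -/
theorem exists_injOn {α β : Type*} [Nontrivial β] (T : Finset (FreeGroup α)) :
    ∃ f : FreeGroup α →* FreeGroup β, Set.InjOn f (T : Set (FreeGroup α)) := by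
  classical
  choose L hL using exists_finset_mem_closure (α := α)
  let S := T.biUnion L
  obtain ⟨φ, hφ⟩ := exists_int_bool_injective
  obtain ⟨a, b, hab⟩ := exists_pair_ne β
  have hι : Function.Injective fun i : Bool => if i then a else b := by
    rintro (_ | _) (_ | _) <;> simp [hab, hab.symm]
  obtain ⟨g, hg⟩ : ∃ g : α → ℤ, Set.InjOn g (S : Set α) := by
    obtain ⟨g, hg⟩ := Countable.exists_injective_nat S
    refine ⟨fun x => if h : x ∈ S then (g ⟨x, h⟩ : ℤ) else 0, fun x hx y hy hxy => ?_⟩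
    simp only [Finset.mem_coe] at hx hy
    simpa [hx, hy, hg.eq_iff] using hxy
  obtain ⟨k, hk⟩ : ∃ k : ℤ → FreeGroup α, ∀ x ∈ S, k (g x) = of x := by
    refine ⟨fun n => if h : ∃ x ∈ S, g x = n then of h.choose else 1, fun x hx => ?_⟩
    have h : ∃ y ∈ S, g y = g x := ⟨x, hx, rfl⟩
    simp only [dif_pos h]
    rw [hg h.choose_spec.1 hx h.choose_spec.2]
  have hid : ∀ x ∈ T, lift k (map g x) = x := by
    intro x hx
    have hle : Subgroup.closure (of '' (L x : Set α)) ≤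
        ((lift k).comp (map g)).eqLocus (MonoidHom.id _) := by
      rw [Subgroup.closure_le]
      rintro _ ⟨y, hy, rfl⟩
      change lift k (map g (of y)) = of y
      rw [map.of, lift_apply_of, hk y (Finset.mem_biUnion.2 ⟨x, hx, hy⟩)]
    exact hle (hL x)
  refine ⟨((map fun i : Bool => if i then a else b).comp φ).comp (map g), fun x hx y hy hxy => ?_⟩
  rw [← hid x hx, ← hid y hy, hφ (map_injective hι hxy)]

/-- Free groups are equationally Noetherian, for equations without constants in finitely many
variables. -/
theorem exists_finset_lift_eq_one {ι : Type} [Finite ι] (β : Type*) (K : Set (FreeGroup ι)) :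
    ∃ K₀ : Finset (FreeGroup ι), (K₀ : Set (FreeGroup ι)) ⊆ K ∧
      ∀ x : ι → FreeGroup β, (∀ w ∈ K₀, lift x w = 1) → ∀ w ∈ K, lift x w = 1 := by
  classical
  obtain ⟨K₀, hsub, hK₀⟩ :=
    Matrix.SpecialLinearGroup.exists_finset_lift_eq_one (m := Fin 2) (A := ℤ) K
  refine ⟨K₀, hsub, fun x hx w hw => ?_⟩
  obtain ⟨ψ, hψ⟩ := Matrix.SpecialLinearGroup.exists_freeGroup_bool_injective
  obtain ⟨φ, hφ⟩ := exists_injOn (β := Bool) ({lift x w, 1} : Finset (FreeGroup β))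
  have hcomp (v : FreeGroup ι) : lift (fun i => ψ (φ (x i))) v = ψ (φ (lift x v)) :=
    (lift_unique (f := fun i => ψ (φ (x i))) ((ψ.comp φ).comp (lift x)) (by simp)).symm
  have h := hK₀ (fun i => ψ (φ (x i)))
    (fun v hv => by rw [hcomp, hx v hv, _root_.map_one, _root_.map_one]) w hw
  rw [hcomp, ← _root_.map_one ψ, hψ.eq_iff, ← _root_.map_one φ] at h
  exact hφ (by simp) (by simp) h

end FreeGroup

namespace grpLang

open FirstOrder.Language

theorem exists_term_realize_eq_lift {n : ℕ} (w : FreeGroup (Fin n)) :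
    ∃ t : grpLang.Term (Empty ⊕ Fin n), ∀ (H : Type) [Group H] (v : Empty → H) (x : Fin n → H),
      t.realize (Sum.elim v x) = FreeGroup.lift x w := by
  induction w using FreeGroup.induction_on with
  | C1 => exact ⟨Term.func (L := grpLang) (l := 0) () ![], fun H _ v x => by
      rw [map_one]; rfl⟩
  | of i => exact ⟨Term.var (Sum.inr i), fun H _ v x => by simp⟩
  | inv_of i h =>
    obtain ⟨t, ht⟩ := h
    refine ⟨Term.func (L := grpLang) (l := 1) () ![t], fun H _ v x => ?_⟩
    rw [map_inv, ← ht H v x]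
    rfl
  | mul w w' h h' =>
    obtain ⟨t, ht⟩ := h
    obtain ⟨t', ht'⟩ := h'
    refine ⟨Term.func (L := grpLang) (l := 2) () ![t, t'], fun H _ v x => ?_⟩
    rw [map_mul, ← ht H v x, ← ht' H v x]
    rfl

theorem exists_isQF_realize_iff_lift_eq_one {n : ℕ} (w : FreeGroup (Fin n)) :
    ∃ ψ : grpLang.BoundedFormula Empty n, ψ.IsQF ∧
      ∀ (H : Type) [Group H] (v : Empty → H) (x : Fin n → H),
        ψ.Realize v x ↔ FreeGroup.lift x w = 1 := by
  obtain ⟨t, ht⟩ := exists_term_realize_eq_lift w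
  obtain ⟨t₁, ht₁⟩ := exists_term_realize_eq_lift (1 : FreeGroup (Fin n))
  refine ⟨t.bdEqual t₁, (BoundedFormula.IsAtomic.equal _ _).isQF, fun H _ v x => ?_⟩
  rw [BoundedFormula.realize_bdEqual, ht, ht₁, map_one]

theorem exists_isQF_realize_iff_forall_lift_eq_one {n : ℕ} (K : Finset (FreeGroup (Fin n))) :
    ∃ ψ : grpLang.BoundedFormula Empty n, ψ.IsQF ∧
      ∀ (H : Type) [Group H] (v : Empty → H) (x : Fin n → H),
        ψ.Realize v x ↔ ∀ w ∈ K, FreeGroup.lift x w = 1 := by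
  classical
  induction K using Finset.induction_on with
  | empty => exact ⟨⊤, .top, by simp⟩
  | insert w K _ ih =>
    obtain ⟨ψ, hψ, h⟩ := ih
    obtain ⟨θ, hθ, h'⟩ := exists_isQF_realize_iff_lift_eq_one w
    exact ⟨θ ⊓ ψ, hθ.inf hψ, by simp [h, h']⟩

theorem exists_isQF_realize_iff_exists_lift_eq_one {n : ℕ} (K : Finset (FreeGroup (Fin n))) :
    ∃ ψ : grpLang.BoundedFormula Empty n, ψ.IsQF ∧
      ∀ (H : Type) [Group H] (v : Empty → H) (x : Fin n → H),
        ψ.Realize v x ↔ ∃ w ∈ K, FreeGroup.lift x w = 1 := by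
  classical
  induction K using Finset.induction_on with
  | empty => exact ⟨⊥, BoundedFormula.isQF_bot, by simp⟩
  | insert w K _ ih =>
    obtain ⟨ψ, hψ, h⟩ := ih
    obtain ⟨θ, hθ, h'⟩ := exists_isQF_realize_iff_lift_eq_one w
    exact ⟨θ ⊔ ψ, hθ.sup hψ, by simp [h, h']⟩

theorem realize_comp_monoidHom {G H γ : Type*} [Group G] [Group H] (f : G →* H)
    (t : grpLang.Term γ) (x : γ → G) : t.realize (f ∘ x) = f (t.realize x) := by
  induction t with
  | var => rfl
  | @func l F ts ih =>
    match l, F with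
    | 0, _ => exact (map_one f).symm
    | 1, _ => exact (congrArg _ (ih 0)).trans (map_inv f _).symm
    | 2, _ => exact (congrArg₂ _ (ih 0) (ih 1)).trans (map_mul f _ _).symm

/-- The truth value of a quantifier-free formula is preserved by all homomorphisms which are
injective on a suitable finite set. -/
theorem exists_finset_realize_iff_of_injOn {n : ℕ} {ψ : grpLang.BoundedFormula Empty n}
    (hψ : ψ.IsQF) {G : Type*} [Group G] (v : Empty → G) (x : Fin n → G) :
    ∃ S : Finset G, ∀ (H : Type) [Group H] (f : G →* H), Set.InjOn f (S : Set G) →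
      (ψ.Realize (f ∘ v) (f ∘ x) ↔ ψ.Realize v x) := by
  classical
  induction hψ with
  | falsum => exact ⟨∅, fun H _ f _ => Iff.rfl⟩
  | of_isAtomic h =>
    cases h with
    | equal t₁ t₂ =>
      refine ⟨{t₁.realize (Sum.elim v x), t₂.realize (Sum.elim v x)}, fun H _ f hf => ?_⟩
      rw [BoundedFormula.realize_bdEqual, BoundedFormula.realize_bdEqual, ← Sum.comp_elim,
        realize_comp_monoidHom, realize_comp_monoidHom]
      exact hf.eq_iff (by simp) (by simp)
    | rel R _ => exact nomatch R
  | imp _ _ ih₁ ih₂ =>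
    obtain ⟨S₁, h₁⟩ := ih₁
    obtain ⟨S₂, h₂⟩ := ih₂
    refine ⟨S₁ ∪ S₂, fun H _ f hf => ?_⟩
    rw [BoundedFormula.realize_imp, BoundedFormula.realize_imp,
      h₁ H f (hf.mono (by simp)), h₂ H f (hf.mono (by simp))]

end grpLang

/-- A finitely generated group satisfies the universal theory of a nonabelian free
group if and only if it is fully residually free. -/
theorem fg_universalTheory_iff_fullyResiduallyFree
    (G : Type) [Group G] (hG : Group.FG G) (β : Type) [Nontrivial β] :
    (∀ φ : grpLang.Sentence, IsUniversalSentence φ →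
        FreeGroup β ⊨ φ → G ⊨ φ) ↔ FullyResiduallyFree G := by
  classical
  constructor
  · intro h S
    obtain ⟨ι, _, π', hπ'⟩ := Group.fg_iff_exists_freeGroup_hom_surjective_finite.1 hG
    obtain ⟨n, ⟨e⟩⟩ := Finite.exists_equiv_fin ι
    let π : FreeGroup (Fin n) →* G := π'.comp (FreeGroup.freeGroupCongr e).symm.toMonoidHom
    have hπ : Function.Surjective π := hπ'.comp (FreeGroup.freeGroupCongr e).symm.surjective
    let x : Fin n → G := fun i => π (FreeGroup.of i)
    have hx (w : FreeGroup (Fin n)) : FreeGroup.lift x w = π w :=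
      (FreeGroup.lift_unique π fun _ => rfl).symm
    obtain ⟨K₀, hsub, hK₀⟩ := FreeGroup.exists_finset_lift_eq_one (ι := Fin n) β π.ker
    let s := Function.surjInv hπ
    have hs (g : G) : π (s g) = g := Function.surjInv_eq hπ g
    let D : Finset (FreeGroup (Fin n)) := S.offDiag.image fun p => (s p.1)⁻¹ * s p.2
    obtain ⟨ψ, hψ, hψr⟩ := grpLang.exists_isQF_realize_iff_forall_lift_eq_one K₀
    obtain ⟨θ, hθ, hθr⟩ := grpLang.exists_isQF_realize_iff_exists_lift_eq_one D
    have hnG : ¬ G ⊨ (ψ.imp θ).alls := by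
      intro hall
      have := Language.BoundedFormula.realize_alls.1 hall x
      rw [Language.BoundedFormula.realize_imp, hψr, hθr] at this
      obtain ⟨w, hw, hw1⟩ := this fun w hw => (hx w).trans (hsub hw)
      obtain ⟨⟨a, b⟩, hab, rfl⟩ := Finset.mem_image.1 hw
      rw [hx, map_mul, map_inv, hs, hs, inv_mul_eq_one] at hw1
      exact (Finset.mem_offDiag.1 hab).2.2 hw1
    have hnF : ¬ FreeGroup β ⊨ (ψ.imp θ).alls :=
      fun hF => hnG (h _ ⟨n, _, hψ.imp hθ, rfl⟩ hF)
    obtain ⟨y, hy⟩ := not_forall.1 (mt Language.BoundedFormula.realize_alls.2 hnF)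
    rw [Language.BoundedFormula.realize_imp, hψr, hθr, Classical.not_imp] at hy
    refine ⟨β, π.liftOfSurjective hπ ⟨FreeGroup.lift y, hK₀ y hy.1⟩, fun a ha b hb hab => ?_⟩
    by_contra hne
    refine hy.2 ⟨_, Finset.mem_image_of_mem _
      (show (a, b) ∈ S.offDiag from Finset.mem_offDiag.2 ⟨ha, hb, hne⟩), ?_⟩
    have hl (w : FreeGroup (Fin n)) :
        π.liftOfSurjective hπ ⟨FreeGroup.lift y, hK₀ y hy.1⟩ (π w) = FreeGroup.lift y w :=
      π.liftOfRightInverse_comp_apply _ _ _ w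
    rw [map_mul, map_inv, ← hl, ← hl, hs, hs, inv_mul_eq_one]
    exact hab
  · rintro h _ ⟨n, ψ, hψ, rfl⟩ hF
    refine Language.BoundedFormula.realize_alls.2 fun x => ?_
    obtain ⟨S, hS⟩ := grpLang.exists_finset_realize_iff_of_injOn hψ default x
    obtain ⟨α, f, hf⟩ := h S
    obtain ⟨g, hg⟩ := FreeGroup.exists_injOn (β := β) (S.image f)
    have hgf : Set.InjOn (g.comp f) (S : Set G) :=
      hg.comp hf fun a ha => Finset.mem_coe.2 (Finset.mem_image_of_mem f ha)
    rw [← hS _ (g.comp f) hgf,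
      Subsingleton.elim (g.comp f ∘ default) Unique.instInhabited.default]
    exact Language.BoundedFormula.realize_alls.1 hF _
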